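/- For every real f > 0 there exists n₀ such that for every integer n ≥ n₀ there is a subset S ⊆ [n]³ with the following properties: no line contains four points of S; n²/(2·(log₂ n)^{1/2}) ≤ |S| ≤ 2n²/(log₂ n)^{1/2}; and every subset T ⊆ S with |T| ≥ n^{5/3+f} contains three points on a common line. -/

import Mathlib

/-- The grid [n]³ = {1, …, n}³ viewed as a subset of ℝ³. -/
def gridPts (n : ℕ) : Set (Fin 3 → ℝ) :=
  {p | ∀ i, ∃ m : ℕ, 1 ≤ m ∧ m ≤ n ∧ p i = (m : ℝ)}


open Finset

set_option linter.unusedSectionVars false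

section Containers

variable {V : Type*} [DecidableEq V]

/-- `P` is covered by a family of at most `K` sets satisfying `R`. -/
def Cov (P R : Finset V → Prop) (K : ℕ) : Prop :=
  ∃ 𝒞 : Finset (Finset V), 𝒞.card ≤ K ∧ (∀ C ∈ 𝒞, R C) ∧ ∀ I, P I → ∃ C ∈ 𝒞, I ⊆ C

lemma Cov.single {P R : Finset V → Prop} {K : ℕ} (C : Finset V) (hK : 1 ≤ K) (hR : R C)
    (h : ∀ I, P I → I ⊆ C) : Cov P R K :=
  ⟨{C}, by simpa using hK, by simpa using hR, fun I hI => ⟨C, by simp, h I hI⟩⟩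

lemma Cov.union {P P₀ P₁ R : Finset V → Prop} {K₀ K₁ K : ℕ} (h₀ : Cov P₀ R K₀)
    (h₁ : Cov P₁ R K₁) (hP : ∀ I, P I → P₀ I ∨ P₁ I) (hK : K₀ + K₁ ≤ K) : Cov P R K := by
  obtain ⟨C₀, a₀, b₀, c₀⟩ := h₀
  obtain ⟨C₁, a₁, b₁, c₁⟩ := h₁
  refine ⟨C₀ ∪ C₁, (card_union_le _ _).trans (by omega), ?_, ?_⟩
  · intro C hC
    rcases mem_union.1 hC with h | h
    · exact b₀ C h
    · exact b₁ C h
  · intro I hI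
    rcases hP I hI with h | h
    · obtain ⟨C, hC, h⟩ := c₀ I h
      exact ⟨C, mem_union_left _ hC, h⟩
    · obtain ⟨C, hC, h⟩ := c₁ I h
      exact ⟨C, mem_union_right _ hC, h⟩

lemma Cov.mono {P P' R R' : Finset V → Prop} {K K' : ℕ} (h : Cov P R K)
    (hP : ∀ I, P' I → P I) (hR : ∀ C, R C → R' C) (hK : K ≤ K') : Cov P' R' K' := by
  obtain ⟨C, a, b, c⟩ := h
  exact ⟨C, a.trans hK, fun D hD => hR _ (b D hD), fun I hI => c I (hP I hI)⟩

lemma Cov.bind {P R R' : Finset V → Prop} {K K' : ℕ} (h : Cov P R K)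
    (h' : ∀ C, R C → Cov (fun I => P I ∧ I ⊆ C) R' K') : Cov P R' (K * K') := by
  obtain ⟨𝒞, a, b, c⟩ := h
  choose! 𝒟 h1 h2 h3 using h'
  refine ⟨𝒞.biUnion 𝒟, ?_, ?_, ?_⟩
  · refine (card_biUnion_le_card_mul _ _ K' (fun C hC => h1 C (b C hC))).trans ?_
    gcongr
  · intro D hD
    obtain ⟨C, hC, hD⟩ := mem_biUnion.1 hD
    exact h2 C (b C hC) D hD
  · intro I hI
    obtain ⟨C, hC, hIC⟩ := c I hI
    obtain ⟨D, hD, hID⟩ := h3 C (b C hC) I ⟨hI, hIC⟩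
    exact ⟨D, mem_biUnion.2 ⟨C, hC, hD⟩, hID⟩

lemma sum_deg (E : Finset (Finset V)) (U : Finset V) (r : ℕ)
    (h : ∀ e ∈ E, e ⊆ U ∧ e.card = r) :
    ∑ x ∈ U, (E.filter (fun e => x ∈ e)).card = E.card * r := by
  have h1 := sum_card_bipartiteAbove_eq_sum_card_bipartiteBelow (s := U) (t := E)
    (fun x e => x ∈ e)
  simp only [bipartiteAbove, bipartiteBelow] at h1
  rw [h1]
  rw [sum_const_nat]
  intro e he
  rw [filter_mem_eq_inter, inter_eq_right.2 (h e he).1, (h e he).2]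

lemma card_le_restrict (E : Finset (Finset V)) (A U : Finset V) (d : ℕ)
    (h : ∀ e ∈ E, e ⊆ A) (hd : ∀ x, (E.filter (fun e => x ∈ e)).card ≤ d) :
    E.card ≤ (E.filter (fun e => e ⊆ U)).card + (A \ U).card * d := by
  have : E ⊆ E.filter (fun e => e ⊆ U) ∪ (A \ U).biUnion (fun x => E.filter (fun e => x ∈ e)) := by
    intro e he
    by_cases h' : e ⊆ U
    · simp [he, h']
    · obtain ⟨x, hx, hxU⟩ := not_subset.1 h'
      refine mem_union_right _ (mem_biUnion.2 ⟨x, ?_, ?_⟩)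
      · simp [h e he hx, hxU]
      · simp [he, hx]
  refine (card_le_card this).trans ((card_union_le _ _).trans ?_)
  gcongr
  exact card_biUnion_le_card_mul _ _ _ (fun x _ => hd x)

lemma pow_step (L k : ℕ) : L ^ (k + 1) + L ^ k ≤ (L + 1) ^ (k + 1) := by
  have : L ^ k ≤ (L + 1) ^ k := Nat.pow_le_pow_left (by omega) k
  calc L ^ (k + 1) + L ^ k = L ^ k * (L + 1) := by ring
    _ ≤ (L + 1) ^ k * (L + 1) := by gcongr
    _ = _ := by ring

/-- The size condition on containers. -/
def SmallSub (A C : Finset V) : Prop := C ⊆ A ∧ 6144 * C.card ≤ 6143 * A.card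

lemma stage_two (A : Finset V) (s : ℕ) (G : Finset (Finset V))
    (hG : ∀ g ∈ G, g ⊆ A ∧ g.card = 2)
    (hdeg : ∀ x, (G.filter (fun g => x ∈ g)).card ≤ 96 * s)
    (hbig : A.card * s ≤ 16 * G.card) :
    ∀ (L k : ℕ) (B F : Finset V), B.card ≤ L → B ⊆ A → F ⊆ A →
      6144 * (F.card + k) ≤ A.card → 3072 * B.card ≤ 3071 * A.card + 192 * s * k →
      Cov (fun I => I ⊆ B ∪ F ∧ ∀ g ∈ G, ¬ g ⊆ I) (SmallSub A) ((L + 1) ^ k) := by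
  intro L
  induction L with
  | zero =>
    intro k B F hL hB hF hk _
    refine Cov.single F (Nat.one_le_pow _ _ (by omega)) ⟨hF, by omega⟩ ?_
    intro I hI
    have : B = ∅ := card_eq_zero.1 (by omega)
    simpa [this] using hI.1
  | succ L ih =>
    intro k B F hL hB hF hk hinv
    by_cases ht : 3072 * B.card ≤ 3071 * A.card
    · refine Cov.single (B ∪ F) (Nat.one_le_pow _ _ (by omega)) ⟨union_subset hB hF, ?_⟩ ?_
      · have := card_union_le B F
        omega
      · exact fun I hI => hI.1
    push Not at ht
    obtain _ | k := k
    · omega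
    have hBA : (A \ B).card + B.card = A.card := card_sdiff_add_card_eq_card hB
    -- find a vertex of high degree
    have hx : ∃ x ∈ B, s ≤ 16 * ((G.filter (fun g => g ⊆ B)).filter (fun g => x ∈ g)).card := by
      by_contra! hcon
      have hne : B.Nonempty := card_pos.1 (by omega)
      have h1 := sum_deg (G.filter (fun g => g ⊆ B)) B 2 (by
        intro e he
        rw [mem_filter] at he
        exact ⟨he.2, (hG e he.1).2⟩)
      have h2 := card_le_restrict G A B (96 * s) (fun e he => (hG e he).1) hdeg
      have h3 : ∑ x ∈ B, 16 * ((G.filter (fun g => g ⊆ B)).filter (fun g => x ∈ g)).card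
          < ∑ x ∈ B, s := sum_lt_sum_of_nonempty hne hcon
      rw [← mul_sum, h1, sum_const, smul_eq_mul] at h3
      have h4 : B.card * s ≤ A.card * s := by gcongr; 
      have h5 : 3072 * (A \ B).card ≤ A.card := by omega
      have h6 : 3072 * (A \ B).card * s ≤ A.card * s := by gcongr
      nlinarith
    obtain ⟨x, hxB, hxd⟩ := hx
    have hLpos : (B.erase x).card + 1 = B.card := card_erase_add_one hxB
    have c0 := ih (k + 1) (B.erase x) F (by omega) ((erase_subset _ _).trans hB) hF hk (by omega)
    have hsub : B.filter (fun y => y ≠ x ∧ ({x, y} : Finset V) ∉ G) ⊆ B.erase x := by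
      intro y hy
      simp only [mem_filter] at hy
      simp [hy]
    have hcard : ((G.filter (fun g => g ⊆ B)).filter (fun g => x ∈ g)).card +
        (B.filter (fun y => y ≠ x ∧ ({x, y} : Finset V) ∉ G)).card ≤ B.card := by
      have e1 : (G.filter (fun g => g ⊆ B)).filter (fun g => x ∈ g) ⊆
          (B.filter (fun y => ¬ (y ≠ x ∧ ({x, y} : Finset V) ∉ G))).image (fun y => {x, y}) := by
        intro g hg
        simp only [mem_filter] at hg
        obtain ⟨⟨hgG, hgB⟩, hxg⟩ := hg
        obtain ⟨y, hy⟩ := card_eq_one.1 (show (g.erase x).card = 1 by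
          rw [card_erase_of_mem hxg, (hG g hgG).2])
        have hg' : g = {x, y} := by rw [← insert_erase hxg, hy]
        refine mem_image.2 ⟨y, ?_, hg'.symm⟩
        rw [mem_filter]
        refine ⟨hgB (by simp [hg']), ?_⟩
        intro h
        exact h.2 (hg' ▸ hgG)
      have e2 := (card_le_card e1).trans card_image_le
      have e3 := card_filter_add_card_filter_not (s := B)
        (fun y => (y ≠ x ∧ ({x, y} : Finset V) ∉ G))
      omega
    have c1 := ih k (B.filter (fun y => y ≠ x ∧ ({x, y} : Finset V) ∉ G)) (insert x F)
      (by have := card_le_card hsub; omega) ((filter_subset _ _).trans hB)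
      (insert_subset (hB hxB) hF) (by have := card_insert_le x F; omega) (by nlinarith)
    refine Cov.union c0 c1 ?_ (pow_step _ _)
    rintro I ⟨hI1, hI2⟩
    by_cases hxI : x ∈ I
    · right
      refine ⟨?_, hI2⟩
      intro y hy
      rcases mem_union.1 (hI1 hy) with h | h
      · by_cases hyx : y = x
        · simp [hyx]
        · refine mem_union_left _ (mem_filter.2 ⟨h, hyx, ?_⟩)
          intro hxy
          exact hI2 _ hxy (by intro z hz; simp at hz; rcases hz with rfl | rfl <;> assumption)
      · exact mem_union_right _ (mem_insert_of_mem h)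
    · left
      refine ⟨?_, hI2⟩
      intro y hy
      have : y ≠ x := fun h => hxI (h ▸ hy)
      rcases mem_union.1 (hI1 hy) with h | h
      · simp [this, h]
      · simp [h]

lemma stage_one (A : Finset V) (s k₂ : ℕ) (H : Finset (Finset V))
    (hs : 0 < s)
    (hH : ∀ e ∈ H, e ⊆ A ∧ e.card = 3)
    (hdeg : ∀ x, (H.filter (fun e => x ∈ e)).card ≤ s ^ 2)
    (hlin : ∀ e ∈ H, ∀ e' ∈ H, ∀ x y, x ≠ y → x ∈ e → y ∈ e → x ∈ e' → y ∈ e' → e = e')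
    (hbig : A.card * s ^ 2 ≤ 12 * H.card)
    (hk₂ : A.card ≤ 192 * s * k₂) :
    ∀ (L k : ℕ) (B F : Finset V) (G : Finset (Finset V)), B.card ≤ L → B ⊆ A → F ⊆ A →
      Disjoint B F →
      6144 * (F.card + k + k₂) ≤ A.card →
      (∀ g ∈ G, g ⊆ A ∧ g.card = 2) →
      (∀ x, (G.filter (fun g => x ∈ g)).card ≤ 96 * s) →
      (∀ g ∈ G, ∃ v ∈ F, v ∉ g ∧ insert v g ∈ H) →
      A.card * s ≤ 16 * G.card + 2 * k * s ^ 2 →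
      G.card ≤ s ^ 2 * F.card →
      s * (F.card + k) ≤ A.card →
      Cov (fun I => I ⊆ B ∪ F ∧ F ⊆ I ∧ ∀ e ∈ H, ¬ e ⊆ I) (SmallSub A) ((L + 1) ^ (k + k₂)) := by
  intro L
  induction L with
  | zero =>
    intro k B F G hL hB hF hBF hk _ _ _ _ _ _
    refine Cov.single F (Nat.one_le_pow _ _ (by omega)) ⟨hF, by omega⟩ ?_
    intro I hI
    have : B = ∅ := card_eq_zero.1 (by omega)
    simpa [this] using hI.1
  | succ L ih =>
    intro k B F G hL hB hF hBF hk hG hGdeg hGH hGbig hGF hsk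
    by_cases ht : 3072 * B.card ≤ 3071 * A.card
    · refine Cov.single (B ∪ F) (Nat.one_le_pow _ _ (by omega)) ⟨union_subset hB hF, ?_⟩ ?_
      · have := card_union_le B F
        omega
      · exact fun I hI => hI.1
    push Not at ht
    have hBA : (A \ B).card + B.card = A.card := card_sdiff_add_card_eq_card hB
    obtain _ | k := k
    · have c := stage_two A s G hG hGdeg (by simpa using hGbig) (L + 1) k₂ B F hL hB hF (by omega)
        (by omega)
      refine c.mono ?_ (fun _ h => h) (by simp)
      rintro I ⟨h1, h2, h3⟩
      refine ⟨h1, fun g hg hgI => ?_⟩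
      obtain ⟨v, hv, _, hvH⟩ := hGH g hg
      exact h3 _ hvH (insert_subset (h2 hv) hgI)
    set Sat := A.filter (fun x => 96 * s ≤ (G.filter (fun g => x ∈ g)).card) with hSat
    have hSatcard : 48 * Sat.card ≤ A.card := by
      have h1 := sum_deg G A 2 hG
      have h2 : ∑ x ∈ Sat, 96 * s ≤ ∑ x ∈ A, (G.filter (fun e => x ∈ e)).card := by
        refine (sum_le_sum (fun x hx => ?_)).trans (sum_le_sum_of_subset (filter_subset _ _))
        exact (mem_filter.1 hx).2
      rw [h1, sum_const, smul_eq_mul] at h2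
      have h3 : s * F.card ≤ A.card := by nlinarith
      have h4 : s * (s * F.card) ≤ s * A.card := by gcongr
      have h5 : s * (48 * Sat.card) ≤ s * A.card := by nlinarith
      exact Nat.le_of_mul_le_mul_left h5 hs
    set U := B \ Sat with hU
    have hUB : U ⊆ B := sdiff_subset
    have hAU : 3072 * (A \ U).card ≤ 65 * A.card := by
      have : A \ U ⊆ (A \ B) ∪ Sat := by
        intro y hy
        simp only [hU, mem_sdiff, mem_union, not_and, not_not] at hy ⊢
        tauto
      have := (card_le_card this).trans (card_union_le _ _)
      omega
    have hx : ∃ x ∈ U, s ^ 2 ≤ 8 * ((H.filter (fun g => g ⊆ U)).filter (fun g => x ∈ g)).card := by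
      by_contra! hcon
      have hne : U.Nonempty := by
        rw [nonempty_iff_ne_empty]
        intro h
        rw [h, sdiff_empty] at hAU
        omega
      have h1 := sum_deg (H.filter (fun g => g ⊆ U)) U 3 (by
        intro e he
        rw [mem_filter] at he
        exact ⟨he.2, (hH e he.1).2⟩)
      have h2 := card_le_restrict H A U (s ^ 2) (fun e he => (hH e he).1) hdeg
      have h3 : ∑ x ∈ U, 8 * ((H.filter (fun g => g ⊆ U)).filter (fun g => x ∈ g)).card
          < ∑ x ∈ U, s ^ 2 := sum_lt_sum_of_nonempty hne hcon
      rw [← mul_sum, h1, sum_const, smul_eq_mul] at h3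
      have h4 : U.card * s ^ 2 ≤ A.card * s ^ 2 := by
        have := card_le_card (hUB.trans hB)
        gcongr
      have h6 : 3072 * (A \ U).card * s ^ 2 ≤ 65 * A.card * s ^ 2 := by gcongr
      nlinarith
    obtain ⟨x, hxU, hxd⟩ := hx
    have hxB := hUB hxU
    have hxF : x ∉ F := disjoint_left.1 hBF hxB
    have hLpos : (B.erase x).card + 1 = B.card := card_erase_add_one hxB
    have c0 := ih (k + 1) (B.erase x) F G (by omega) ((erase_subset _ _).trans hB) hF
      (hBF.mono_left (erase_subset _ _)) hk hG hGdeg hGH hGbig hGF hsk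
    set Hx := (H.filter (fun g => g ⊆ U)).filter (fun g => x ∈ g) with hHx
    have hHx' : ∀ e ∈ Hx, e ∈ H ∧ e ⊆ U ∧ x ∈ e := by
      intro e he
      simp only [hHx, mem_filter] at he
      tauto
    set Lk := Hx.image (fun e => e.erase x) with hLk
    have hLk' : ∀ g ∈ Lk, x ∉ g ∧ insert x g ∈ H ∧ g ⊆ U ∧ g.card = 2 := by
      intro g hg
      obtain ⟨e, he, rfl⟩ := mem_image.1 hg
      obtain ⟨a, b, c⟩ := hHx' e he
      refine ⟨by simp, by rwa [insert_erase c], (erase_subset _ _).trans b, ?_⟩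
      rw [card_erase_of_mem c, (hH e a).2]
    have hLkcard : Lk.card = Hx.card := by
      refine card_image_of_injOn ?_
      intro e he e' he' h
      simp only at h
      rw [← insert_erase (hHx' e he).2.2, h, insert_erase (hHx' e' he').2.2]
    have hLkle : Lk.card ≤ s ^ 2 := by
      rw [hLkcard]
      refine (card_le_card ?_).trans (hdeg x)
      intro e he
      obtain ⟨a, b, c⟩ := hHx' e he
      simp [a, c]
    have hdisj : Disjoint G Lk := by
      rw [disjoint_left]
      intro g hg hg'
      obtain ⟨v, hv, hvg, hvH⟩ := hGH g hg
      obtain ⟨a, b, -, -⟩ := hLk' g hg'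
      obtain ⟨y, z, hyz, hg2⟩ := card_eq_two.1 (hG g hg).2
      have := hlin _ hvH _ b y z hyz (by simp [hg2]) (by simp [hg2]) (by simp [hg2]) (by simp [hg2])
      have hv' : v ∈ insert x g := this ▸ mem_insert_self v g
      rcases mem_insert.1 hv' with h | h
      · exact hxF (h ▸ hv)
      · exact hvg h
    have hcardG : (G ∪ Lk).card = G.card + Lk.card := card_union_of_disjoint hdisj
    have hFc : (insert x F).card = F.card + 1 := card_insert_of_notMem hxF
    have c1 := ih k (B.erase x) (insert x F) (G ∪ Lk) (by omega) ((erase_subset _ _).trans hB)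
      (insert_subset (hB hxB) hF) (by
        rw [disjoint_insert_right]
        exact ⟨by simp, hBF.mono_left (erase_subset _ _)⟩)
      (by omega)
      (by
        intro g hg
        rcases mem_union.1 hg with h | h
        · exact hG g h
        · obtain ⟨-, -, c, d⟩ := hLk' g h
          exact ⟨c.trans (hUB.trans hB), d⟩)
      (by
        intro y
        rw [filter_union]
        refine (card_union_le _ _).trans ?_
        by_cases hy : y ∈ U
        · have hlt : (G.filter (fun g => y ∈ g)).card < 96 * s := by
            by_contra! hcon
            have : y ∉ Sat := (mem_sdiff.1 hy).2
            exact this (mem_filter.2 ⟨hB (hUB hy), hcon⟩)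
          have hle : (Lk.filter (fun g => y ∈ g)).card ≤ 1 := by
            rw [card_le_one]
            intro g hg g' hg'
            rw [mem_filter] at hg hg'
            obtain ⟨a, b, -, -⟩ := hLk' g hg.1
            obtain ⟨a', b', -, -⟩ := hLk' g' hg'.1
            have hxy : x ≠ y := fun h => a (h ▸ hg.2)
            have := hlin _ b _ b' x y hxy (by simp) (by simp [hg.2]) (by simp) (by simp [hg'.2])
            rw [← erase_insert a, this, erase_insert a']
          omega
        · have : Lk.filter (fun g => y ∈ g) = ∅ := by
            rw [filter_eq_empty_iff]
            intro g hg hyg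
            exact hy ((hLk' g hg).2.2.1 hyg)
          rw [this]
          simpa using hGdeg y)
      (by
        intro g hg
        rcases mem_union.1 hg with h | h
        · obtain ⟨v, hv, h'⟩ := hGH g h
          exact ⟨v, mem_insert_of_mem hv, h'⟩
        · obtain ⟨a, b, -, -⟩ := hLk' g h
          exact ⟨x, mem_insert_self _ _, a, b⟩)
      (by rw [hcardG, hLkcard]; nlinarith)
      (by rw [hcardG, hFc]; nlinarith)
      (by rw [hFc]; linarith [hsk])
    refine Cov.union c0 c1 ?_ ?_
    · rintro I ⟨hI1, hI2, hI3⟩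
      by_cases hxI : x ∈ I
      · right
        refine ⟨?_, insert_subset hxI hI2, hI3⟩
        intro y hy
        by_cases hyx : y = x
        · simp [hyx]
        · have := hI1 hy
          simp only [mem_union, mem_erase, mem_insert] at this ⊢
          tauto
      · left
        refine ⟨?_, hI2, hI3⟩
        intro y hy
        have hyx : y ≠ x := fun h => hxI (h ▸ hy)
        have := hI1 hy
        simp only [mem_union, mem_erase] at this ⊢
        tauto
    · have := pow_step (L + 1) (k + k₂)
      rw [show k + 1 + k₂ = k + k₂ + 1 by ring]
      exact this

/-- Container step for linear 3-uniform hypergraphs. -/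
lemma container_step (A : Finset V) (s : ℕ) (H : Finset (Finset V))
    (hs : 12288 ≤ s) (hsA : s ≤ A.card)
    (hH : ∀ e ∈ H, e ⊆ A ∧ e.card = 3)
    (hdeg : ∀ x, (H.filter (fun e => x ∈ e)).card ≤ s ^ 2)
    (hlin : ∀ e ∈ H, ∀ e' ∈ H, ∀ x y, x ≠ y → x ∈ e → y ∈ e → x ∈ e' → y ∈ e' → e = e')
    (hbig : A.card * s ^ 2 ≤ 12 * H.card) :
    Cov (fun I => I ⊆ A ∧ ∀ e ∈ H, ¬ e ⊆ I) (SmallSub A) ((A.card + 1) ^ (2 * (A.card / s))) := by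
  set k := A.card / s with hk
  have h1 : s * k ≤ A.card := Nat.mul_div_le _ _
  have h2 : A.card ≤ 2 * (s * k) := by
    have := Nat.lt_mul_div_succ A.card (show 0 < s by omega)
    have hk1 : 1 ≤ k := (Nat.one_le_div_iff (by omega)).2 hsA
    have : s ≤ s * k := Nat.le_mul_of_pos_right _ hk1
    rw [← hk] at *
    nlinarith
  have h3 : 12288 * k ≤ s * k := by gcongr
  have := stage_one A s k H (by omega) hH hdeg hlin hbig (by nlinarith) A.card k A ∅ ∅ le_rfl
    (Subset.refl _) (by simp) (by simp) (by simp; omega) (by simp) (by simp) (by simp)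
    (by simp; nlinarith) (by simp) (by simpa using h1)
  refine this.mono ?_ (fun _ h => h) (by rw [two_mul])
  rintro I ⟨a, b⟩
  exact ⟨by simpa using a, by simp, b⟩

end Containers

section Geometry

/-- Integer points. -/
abbrev Pt := Fin 3 → ℤ

/-- The integer grid. -/
noncomputable def grid (n : ℕ) : Finset Pt := Fintype.piFinset (fun _ : Fin 3 => Finset.Icc (1 : ℤ) n)

lemma mem_grid {n : ℕ} {x : Pt} : x ∈ grid n ↔ ∀ i, 1 ≤ x i ∧ x i ≤ n := by
  simp [grid, Fintype.mem_piFinset]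

lemma card_grid (n : ℕ) : (grid n).card = n ^ 3 := by
  simp [grid, Fintype.card_piFinset]

/-- Collinearity of integer points. -/
def IsCol (Q : Finset Pt) : Prop := ∃ a u : Pt, ∀ x ∈ Q, ∃ k : ℤ, x = a + k • u

/-- No collinear triple. -/
def FreeSet (I : Finset Pt) : Prop := ∀ Q ⊆ I, Q.card = 3 → ¬ IsCol Q

/-- Primitive vectors (in Bezout form). -/
def Prim (u : Pt) : Prop := ∃ l : Pt, l 0 * u 0 + l 1 * u 1 + l 2 * u 2 = 1

lemma prim_param {u w : Pt} (hu : Prim u) (h : ∀ i j, w i * u j = w j * u i) :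
    ∃ k : ℤ, w = k • u := by
  obtain ⟨l, hl⟩ := hu
  refine ⟨l 0 * w 0 + l 1 * w 1 + l 2 * w 2, ?_⟩
  funext i
  simp only [Pi.smul_apply, smul_eq_mul]
  have h0 := h i 0
  have h1 := h i 1
  have h2 := h i 2
  linear_combination (-w i) * hl + l 0 * h0 + l 1 * h1 + l 2 * h2

lemma exists_bezout (w : Pt) : ∃ (g : ℕ) (l : Pt), (∀ i, (g : ℤ) ∣ w i) ∧
    l 0 * w 0 + l 1 * w 1 + l 2 * w 2 = g := by
  refine ⟨Int.gcd (w 0) (Int.gcd (w 1) (w 2)),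
    ![Int.gcdA (w 0) (Int.gcd (w 1) (w 2)),
      Int.gcdB (w 0) (Int.gcd (w 1) (w 2)) * Int.gcdA (w 1) (w 2),
      Int.gcdB (w 0) (Int.gcd (w 1) (w 2)) * Int.gcdB (w 1) (w 2)], ?_, ?_⟩
  · have h := Int.gcd_dvd_right (w 0) (Int.gcd (w 1) (w 2))
    intro i
    fin_cases i
    · exact Int.gcd_dvd_left _ _
    · exact h.trans (Int.gcd_dvd_left _ _)
    · exact h.trans (Int.gcd_dvd_right _ _)
  · have h1 := Int.gcd_eq_gcd_ab (w 0) (Int.gcd (w 1) (w 2))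
    have h2 := Int.gcd_eq_gcd_ab (w 1) (w 2)
    rw [h1]
    simp only [Matrix.cons_val_zero, Matrix.cons_val_one, Matrix.cons_val]
    linear_combination (-(Int.gcdB (w 0) (Int.gcd (w 1) (w 2)))) * h2

lemma exists_prim {w : Pt} (hw : w ≠ 0) : ∃ (u : Pt) (g : ℤ), Prim u ∧ 0 < g ∧ w = g • u := by
  obtain ⟨g, l, hd, hl⟩ := exists_bezout w
  choose u hu using hd
  have hg : (g : ℤ) ≠ 0 := by
    intro h
    apply hw
    funext i
    simp [hu i, h]
  refine ⟨u, g, ⟨l, ?_⟩, by positivity, ?_⟩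
  · apply mul_left_cancel₀ hg
    linear_combination hl - l 0 * hu 0 - l 1 * hu 1 - l 2 * hu 2
  · funext i
    simp [hu i]

open Classical in
/-- Primitive directions in `[1,r]³`. -/
noncomputable def dirs (r : ℕ) : Finset Pt := (grid r).filter Prim

lemma sum_inv_cube (r : ℕ) : ∑ k ∈ Finset.Icc 2 r, (1 : ℝ) / (k : ℝ) ^ 3 ≤ 1 / 2 := by
  have key : ∀ r : ℕ, ∑ k ∈ Finset.Icc 2 (r + 1), (1 : ℝ) / (k : ℝ) ^ 3 ≤ 1 / 2 - 1 / (2 * (r + 1)) := by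
    intro r
    induction r with
    | zero => simp
    | succ r ih =>
      rw [Finset.sum_Icc_succ_top (by omega)]
      have : (1 : ℝ) / ((r + 1 + 1 : ℕ) : ℝ) ^ 3 ≤ 1 / (2 * (r + 1)) - 1 / (2 * (r + 1 + 1)) := by
        have hr : (0 : ℝ) ≤ r := by positivity
        push_cast
        rw [div_sub_div _ _ (by positivity) (by positivity), div_le_div_iff₀ (by positivity) (by positivity)]
        nlinarith [mul_nonneg hr hr, mul_nonneg hr (mul_nonneg hr hr)]
      push_cast at this ⊢
      linarith
  rcases r with _ | r
  · simp
  · refine (key r).trans ?_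
    have : (0 : ℝ) ≤ 1 / (2 * (r + 1)) := by positivity
    linarith

lemma card_dirs (r : ℕ) : r ^ 3 ≤ 2 * (dirs r).card := by
  classical
  have h1 : (grid r).filter (fun u => ¬ Prim u) ⊆ (Finset.Icc 2 r).biUnion (fun k =>
      (grid (r / k)).image (fun v => (k : ℤ) • v)) := by
    intro u hu
    rw [mem_filter] at hu
    obtain ⟨hg, hnp⟩ := hu
    rw [mem_grid] at hg
    obtain ⟨g, l, hd, hl⟩ := exists_bezout u
    have hg1 : g ≠ 1 := by
      rintro rfl
      exact hnp ⟨l, by simpa using hl⟩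
    have hg0 : g ≠ 0 := by
      rintro rfl
      have := hd 0
      have h2 := hg 0
      simp at this
      omega
    have hgr : g ≤ r := by
      have := Int.le_of_dvd (by have := hg 0; omega) (hd 0)
      have := hg 0
      omega
    rw [mem_biUnion]
    refine ⟨g, by rw [Finset.mem_Icc]; omega, ?_⟩
    choose v hv using hd
    refine mem_image.2 ⟨v, ?_, ?_⟩
    · rw [mem_grid]
      intro i
      have hi := hg i
      rw [hv i] at hi
      have hgpos : (0 : ℤ) < g := by positivity
      constructor
      · by_contra! hcon
        nlinarith
      · push_cast
        rw [Int.le_ediv_iff_mul_le hgpos]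
        linarith [hi.2]
    · funext i
      simp [hv i]
  have h2 : ((grid r).filter (fun u => ¬ Prim u)).card ≤ ∑ k ∈ Finset.Icc 2 r, (r / k) ^ 3 := by
    refine (card_le_card h1).trans (card_biUnion_le.trans (sum_le_sum fun k _ => ?_))
    refine card_image_le.trans ?_
    rw [card_grid]
  have h3 : ((∑ k ∈ Finset.Icc 2 r, (r / k) ^ 3 : ℕ) : ℝ) ≤ (r : ℝ) ^ 3 / 2 := by
    push_cast
    have : ∀ k ∈ Finset.Icc 2 r, (((r / k : ℕ) : ℝ)) ^ 3 ≤ (r : ℝ) ^ 3 * (1 / (k : ℝ) ^ 3) := by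
      intro k _
      rw [mul_one_div, ← div_pow]
      gcongr
      exact Nat.cast_div_le
    refine (sum_le_sum this).trans ?_
    rw [← mul_sum]
    have := sum_inv_cube r
    have h0 : (0 : ℝ) ≤ (r : ℝ) ^ 3 := by positivity
    nlinarith
  have h4 := card_filter_add_card_filter_not (s := grid r) Prim
  rw [card_grid] at h4
  have h5 : 2 * ((grid r).filter (fun u => ¬ Prim u)).card ≤ r ^ 3 := by
    have : ((((grid r).filter (fun u => ¬ Prim u)).card : ℕ) : ℝ) ≤ (r : ℝ) ^ 3 / 2 :=
      le_trans (by exact_mod_cast h2) h3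
    have h6 : ((2 * ((grid r).filter (fun u => ¬ Prim u)).card : ℕ) : ℝ) ≤ ((r ^ 3 : ℕ) : ℝ) := by
      push_cast
      linarith
    exact_mod_cast h6
  unfold dirs
  omega

lemma card_dirs_le (r : ℕ) : (dirs r).card ≤ r ^ 3 := by
  classical
  rw [← card_grid]
  unfold dirs
  exact card_filter_le _ _

lemma exists_rep {n r : ℕ} {u : Pt} (hu : u ∈ grid r) :
    ∀ (m : ℕ) (x : Pt), x ∈ grid n → (x 0).toNat ≤ m →
      ∃ b ∈ grid n, (∃ k : ℤ, x - b = k • u) ∧ ∃ i, b i ≤ r := by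
  rw [mem_grid] at hu
  intro m
  induction m with
  | zero =>
    intro x hx hm
    have := (mem_grid.1 hx) 0
    omega
  | succ m ih =>
    intro x hx hm
    by_cases h : ∃ i, x i ≤ r
    · exact ⟨x, hx, ⟨0, by simp⟩, h⟩
    · push Not at h
      rw [mem_grid] at hx
      obtain ⟨b, hb, ⟨k, hk⟩, hi⟩ := ih (x - u) (by
        rw [mem_grid]
        intro i
        have := hu i
        have := hx i
        have := h i
        simp only [Pi.sub_apply]
        omega) (by
        have := hu 0
        simp only [Pi.sub_apply]
        omega)
      refine ⟨b, hb, ⟨k + 1, ?_⟩, hi⟩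
      rw [add_smul, ← hk, one_smul]
      abel

lemma card_boundary (n r : ℕ) :
    ((grid n).filter (fun b : Pt => ∃ i, b i ≤ (r : ℤ))).card ≤ 3 * (r * n ^ 2) := by
  have h1 : (grid n).filter (fun b : Pt => ∃ i, b i ≤ (r : ℤ)) ⊆ (Finset.univ : Finset (Fin 3)).biUnion
      (fun i => Fintype.piFinset (fun j : Fin 3 => if j = i then Finset.Icc (1 : ℤ) r
        else Finset.Icc (1 : ℤ) n)) := by
    intro b hb
    rw [mem_filter, mem_grid] at hb
    obtain ⟨hb, i, hi⟩ := hb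
    refine mem_biUnion.2 ⟨i, mem_univ _, ?_⟩
    rw [Fintype.mem_piFinset]
    intro j
    by_cases h : j = i
    · subst h
      simp [(hb j).1, hi]
    · simp [h, hb j]
  refine (card_le_card h1).trans ((card_biUnion_le_card_mul _ _ (r * n ^ 2) ?_).trans (by simp))
  intro i _
  rw [Fintype.card_piFinset, Fin.prod_univ_three]
  fin_cases i <;> simp <;> apply le_of_eq <;> ring

/-- parallel to `u`. -/
def Par (u : Pt) (e : Finset Pt) : Prop := ∀ x ∈ e, ∀ y ∈ e, ∃ k : ℤ, x - y = k • u

lemma exists_matching {n r : ℕ} {u : Pt} (hu : u ∈ grid r) (A : Finset Pt) (hA : A ⊆ grid n) :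
    ∃ M : Finset (Finset Pt), (∀ e ∈ M, e ⊆ A ∧ e.card = 3 ∧ Par u e) ∧
      (∀ e ∈ M, ∀ e' ∈ M, ∀ x, x ∈ e → x ∈ e' → e = e') ∧
      A.card ≤ 3 * M.card + 6 * (r * n ^ 2) := by
  classical
  set 𝓜 := ((A.powersetCard 3).filter (Par u)).powerset.filter
    (fun M => ∀ e ∈ M, ∀ e' ∈ M, ∀ x, x ∈ e → x ∈ e' → e = e') with h𝓜
  have hne : 𝓜.Nonempty := ⟨∅, by simp [h𝓜]⟩
  obtain ⟨M, hM, hmax⟩ := exists_max_image 𝓜 card hne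
  simp only [h𝓜, mem_filter, mem_powerset] at hM
  obtain ⟨hM1, hM2⟩ := hM
  have hM1' : ∀ e ∈ M, e ⊆ A ∧ e.card = 3 ∧ Par u e := by
    intro e he
    have := hM1 he
    rw [mem_filter, mem_powersetCard] at this
    tauto
  refine ⟨M, hM1', hM2, ?_⟩
  set Lo := A \ M.biUnion id with hLo
  have hcov : A.card ≤ 3 * M.card + Lo.card := by
    have h1 : A ⊆ M.biUnion id ∪ Lo := by
      intro x hx
      by_cases h : x ∈ M.biUnion id
      · exact mem_union_left _ h
      · exact mem_union_right _ (mem_sdiff.2 ⟨hx, h⟩)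
    have h2 : (M.biUnion id).card ≤ M.card * 3 :=
      card_biUnion_le_card_mul _ _ _ (fun e he => (hM1' e he).2.1.le)
    have := (card_le_card h1).trans (card_union_le _ _)
    omega
  have hrep : ∀ x : Pt, x ∈ grid n → ∃ b ∈ grid n, (∃ k : ℤ, x - b = k • u) ∧ ∃ i, b i ≤ r :=
    fun x hx => exists_rep hu _ x hx le_rfl
  choose! φ hφ1 hφ2 hφ3 using hrep
  have hLoA : ∀ x ∈ Lo, x ∈ grid n := fun x hx => hA (mem_sdiff.1 hx).1
  have hfib : ∀ b ∈ Lo.image φ, (Lo.filter (fun x => φ x = b)).card ≤ 2 := by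
    intro b _
    by_contra! hcon
    obtain ⟨e, he, hec⟩ := exists_subset_card_eq (show 3 ≤ _ from hcon)
    have heL : ∀ x ∈ e, x ∈ Lo ∧ φ x = b := fun x hx => mem_filter.1 (he hx)
    have hpar : Par u e := by
      intro x hx y hy
      obtain ⟨k, hk⟩ := hφ2 x (hLoA x (heL x hx).1)
      obtain ⟨k', hk'⟩ := hφ2 y (hLoA y (heL y hy).1)
      rw [(heL x hx).2] at hk
      rw [(heL y hy).2] at hk'
      refine ⟨k - k', ?_⟩
      rw [sub_smul, ← hk, ← hk']
      abel
    have hdisj : ∀ e' ∈ M, ∀ x, x ∈ e → x ∉ e' := by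
      intro e' he' x hx hx'
      exact (mem_sdiff.1 (heL x hx).1).2 (mem_biUnion.2 ⟨e', he', hx'⟩)
    have heM : e ∉ M := by
      intro h
      obtain ⟨x, hx⟩ := card_pos.1 (show 0 < e.card by omega)
      exact hdisj e h x hx hx
    have := hmax (insert e M) (by
      simp only [h𝓜, mem_filter, mem_powerset]
      refine ⟨insert_subset ?_ hM1, ?_⟩
      · rw [mem_filter, mem_powersetCard]
        exact ⟨⟨fun x hx => (mem_sdiff.1 (heL x hx).1).1, hec⟩, hpar⟩
      · intro e1 h1 e2 h2 x hx1 hx2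
        rcases mem_insert.1 h1 with q1 | q1 <;> rcases mem_insert.1 h2 with q2 | q2
        · rw [q1, q2]
        · exact absurd hx2 (hdisj _ q2 x (q1 ▸ hx1))
        · exact absurd hx1 (hdisj _ q1 x (q2 ▸ hx2))
        · exact hM2 _ q1 _ q2 x hx1 hx2)
    rw [card_insert_of_notMem heM] at this
    omega
  have h5 := card_le_mul_card_image Lo 2 hfib
  have h6 : (Lo.image φ).card ≤ 3 * (r * n ^ 2) := by
    refine (card_le_card ?_).trans (card_boundary n r)
    intro b hb
    obtain ⟨x, hx, rfl⟩ := mem_image.1 hb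
    exact mem_filter.2 ⟨hφ1 x (hLoA x hx), hφ3 x (hLoA x hx)⟩
  omega

lemma dir_unique {r : ℕ} {u u' x y : Pt} (hu : u ∈ dirs r) (hu' : u' ∈ dirs r) (hxy : x ≠ y)
    (h : ∃ k : ℤ, x - y = k • u) (h' : ∃ k : ℤ, x - y = k • u') : u = u' := by
  classical
  unfold dirs at hu hu'
  rw [mem_filter, mem_grid] at hu hu'
  obtain ⟨k, hk⟩ := h
  obtain ⟨k', hk'⟩ := h'
  have hk0 : k ≠ 0 := by
    rintro rfl
    rw [zero_smul, sub_eq_zero] at hk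
    exact hxy hk
  have hc : ∀ i, k * u i = k' * u' i := by
    intro i
    have := congrFun (hk.symm.trans hk') i
    simpa using this
  have hcross : ∀ i j, u i * u' j = u j * u' i := by
    intro i j
    apply mul_left_cancel₀ hk0
    linear_combination u' j * hc i - u' i * hc j
  obtain ⟨c, h1⟩ := prim_param hu'.2 hcross
  obtain ⟨c', h2⟩ := prim_param hu.2 (w := u') (fun i j => by linear_combination - hcross i j)
  have e1 : u 0 = c * u' 0 := by simpa using congrFun h1 0
  have e2 : u' 0 = c' * u 0 := by simpa using congrFun h2 0
  have p1 := (hu.1 0).1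
  have p2 := (hu'.1 0).1
  have hc1 : 1 ≤ c := by by_contra! hcon; nlinarith
  have hc2 : 1 ≤ c' := by by_contra! hcon; nlinarith
  have : c = 1 := by
    by_contra hcon
    have : 2 ≤ c := by omega
    nlinarith
  rw [h1, this, one_smul]

lemma geom_step {n t : ℕ} (A : Finset Pt) (hA : A ⊆ grid n) (hn : 1 ≤ n) (ht : 24 ≤ t)
    (hAt : 12 * (t ^ 2 * n ^ 2) ≤ A.card) :
    Cov (fun I => I ⊆ A ∧ FreeSet I) (SmallSub A)
      ((A.card + 1) ^ (2 * (A.card / t ^ 3))) := by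
  classical
  set D := dirs (t ^ 2) with hD
  have hDg : ∀ u ∈ D, u ∈ grid (t ^ 2) := fun u hu => (mem_filter.1 hu).1
  have hm : ∀ u ∈ D, _ := fun u hu => exists_matching (hDg u hu) A hA
  choose! M hM1 hM2 hM3 using hm
  set H := D.biUnion M with hH
  have hHmem : ∀ e ∈ H, ∃ u ∈ D, e ∈ M u := fun e he => mem_biUnion.1 he
  have huniq : ∀ u ∈ D, ∀ u' ∈ D, ∀ e ∈ M u, ∀ e' ∈ M u', ∀ x y, x ≠ y → x ∈ e → y ∈ e → x ∈ e' →
      y ∈ e' → u = u' := by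
    intro u hu u' hu' e he e' he' x y hxy hx hy hx' hy'
    exact dir_unique hu hu' hxy ((hM1 u hu e he).2.2 x hx y hy) ((hM1 u' hu' e' he').2.2 x hx' y hy')
  have hcardH : H.card = ∑ u ∈ D, (M u).card := by
    refine card_biUnion ?_
    intro u hu u' hu' hne
    refine disjoint_left.2 ?_
    intro e he he'
    apply hne
    obtain ⟨x, hx, y, hy, hxy⟩ := one_lt_card.1 (show 1 < e.card by rw [(hM1 u hu e he).2.1]; omega)
    exact huniq u hu u' hu' e he e he' x y hxy hx hy hx hy
  have hs : 12288 ≤ t ^ 3 := by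
    calc 12288 ≤ 24 ^ 3 := by norm_num
      _ ≤ t ^ 3 := by gcongr
  have hAn : A.card ≤ n ^ 3 := by
    rw [← card_grid]
    exact card_le_card hA
  have htn : t ≤ n := by
    by_contra! hcon
    have h1 : n ^ 3 = n * n ^ 2 := by ring
    have h2 : n * n ^ 2 ≤ t ^ 2 * n ^ 2 := by
      gcongr
      nlinarith
    have h3 : 0 < t ^ 2 * n ^ 2 := by
      positivity
    omega
  have hsA : t ^ 3 ≤ A.card := by
    refine le_trans ?_ hAt
    calc t ^ 3 = t ^ 2 * t := by ring
      _ ≤ t ^ 2 * n ^ 2 := by gcongr; nlinarith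
      _ ≤ _ := by omega
  refine (container_step A (t ^ 3) H hs hsA ?_ ?_ ?_ ?_).mono ?_ (fun _ h => h) le_rfl
  · intro e he
    obtain ⟨u, hu, he⟩ := hHmem e he
    exact ⟨(hM1 u hu e he).1, (hM1 u hu e he).2.1⟩
  · intro x
    have : H.filter (fun e => x ∈ e) ⊆ D.biUnion (fun u => (M u).filter (fun e => x ∈ e)) := by
      intro e he
      rw [mem_filter] at he
      obtain ⟨u, hu, he'⟩ := hHmem e he.1
      exact mem_biUnion.2 ⟨u, hu, mem_filter.2 ⟨he', he.2⟩⟩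
    refine (card_le_card this).trans ((card_biUnion_le_card_mul _ _ 1 ?_).trans ?_)
    · intro u hu
      rw [card_le_one]
      intro e he e' he'
      rw [mem_filter] at he he'
      exact hM2 u hu e he.1 e' he'.1 x he.2 he'.2
    · have := card_dirs_le (t ^ 2)
      calc D.card * 1 = D.card := mul_one _
        _ ≤ (t ^ 2) ^ 3 := this
        _ = _ := by ring
  · intro e he e' he' x y hxy hx hy hx' hy'
    obtain ⟨u, hu, he⟩ := hHmem e he
    obtain ⟨u', hu', he'⟩ := hHmem e' he'
    have := huniq u hu u' hu' e he e' he' x y hxy hx hy hx' hy'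
    subst this
    exact hM2 u hu e he e' he' x hx hx'
  · have h1 : D.card * A.card ≤ 6 * H.card := by
      rw [hcardH, mul_sum]
      calc D.card * A.card = ∑ u ∈ D, A.card := by simp
        _ ≤ _ := by
          refine sum_le_sum (fun u hu => ?_)
          have := hM3 u hu
          omega
    have h2 := card_dirs (t ^ 2)
    calc A.card * (t ^ 3) ^ 2 = A.card * (t ^ 2) ^ 3 := by ring
      _ ≤ A.card * (2 * D.card) := by gcongr
      _ ≤ _ := by nlinarith
  · rintro I ⟨hI1, hI2⟩
    refine ⟨hI1, fun e he heI => ?_⟩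
    obtain ⟨u, hu, he⟩ := hHmem e he
    obtain ⟨-, h3, hp⟩ := hM1 u hu e he
    obtain ⟨a, ha⟩ := card_pos.1 (show 0 < e.card by omega)
    refine hI2 e heI h3 ⟨a, u, fun x hx => ?_⟩
    obtain ⟨k, hk⟩ := hp x hx a ha
    exact ⟨k, by rw [← hk]; abel⟩

end Geometry

section Iteration

lemma iterate_step {n : ℕ} {x : ℝ} (hx : 24 ≤ x) (hxn : x ^ 3 = n) (A : Finset Pt)
    (hA : A ⊆ grid n) (hbig : 12 * x ^ 8 ≤ A.card) :
    Cov (fun I => I ⊆ A ∧ FreeSet I) (SmallSub A) ((n ^ 3 + 1) ^ ⌈192 * x ^ 5⌉₊) := by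
  have hx0 : 0 < x := by linarith
  have hn : 1 ≤ n := by
    have : (0 : ℝ) < n := by rw [← hxn]; positivity
    exact_mod_cast this
  have hn0 : (0 : ℝ) < n := by exact_mod_cast hn
  set y := Real.sqrt (A.card / (12 * (n : ℝ) ^ 2)) with hy
  have hy2 : y ^ 2 * (12 * (n : ℝ) ^ 2) = A.card := by
    rw [hy, Real.sq_sqrt (by positivity)]
    field_simp
  have hy0 : 0 ≤ y := Real.sqrt_nonneg _
  have hxy : x ≤ y := by
    apply Real.le_sqrt_of_sq_le
    rw [le_div_iff₀ (by positivity), ← hxn]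
    linarith [show x ^ 2 * (12 * (x ^ 3) ^ 2) = 12 * x ^ 8 by ring]
  set t := ⌊y⌋₊ with ht
  have ht1 : (t : ℝ) ≤ y := Nat.floor_le hy0
  have ht2 : y < t + 1 := Nat.lt_floor_add_one y
  have ht3 : y ≤ 2 * t := by linarith
  have ht24 : 24 ≤ t := Nat.le_floor (by push_cast; linarith)
  have hAt : 12 * (t ^ 2 * n ^ 2) ≤ A.card := by
    have : ((12 * (t ^ 2 * n ^ 2) : ℕ) : ℝ) ≤ A.card := by
      push_cast
      rw [← hy2]
      have : (t : ℝ) ^ 2 ≤ y ^ 2 := by gcongr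
      nlinarith [sq_nonneg (n : ℝ)]
    exact_mod_cast this
  refine (geom_step A hA hn ht24 hAt).mono (fun _ h => h) (fun _ h => h) ?_
  have hAn : A.card ≤ n ^ 3 := by
    rw [← card_grid]
    exact card_le_card hA
  have hk : 2 * (A.card / t ^ 3) ≤ ⌈192 * x ^ 5⌉₊ := by
    have ht0 : (0 : ℝ) < t := by positivity
    have h1 : ((A.card / t ^ 3 : ℕ) : ℝ) ≤ 96 * x ^ 5 := by
      refine Nat.cast_div_le.trans ?_
      push_cast
      rw [div_le_iff₀ (by positivity), ← hy2, ← hxn]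
      have h2 : y ^ 3 ≤ (2 * t) ^ 3 := by gcongr
      have h3 : x * y ^ 2 ≤ y ^ 3 := by nlinarith [sq_nonneg y]
      have h4 : 0 ≤ x ^ 5 := by positivity
      calc y ^ 2 * (12 * (x ^ 3) ^ 2) = 12 * x ^ 5 * (x * y ^ 2) := by ring
        _ ≤ 12 * x ^ 5 * ((2 * t) ^ 3) := by gcongr; exact h3.trans h2
        _ = _ := by ring
    have h5 : ((2 * (A.card / t ^ 3) : ℕ) : ℝ) ≤ ((⌈192 * x ^ 5⌉₊ : ℕ) : ℝ) := by
      refine le_trans ?_ (Nat.le_ceil _)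
      push_cast at h1 ⊢
      linarith
    exact_mod_cast h5
  calc (A.card + 1) ^ (2 * (A.card / t ^ 3)) ≤ (n ^ 3 + 1) ^ (2 * (A.card / t ^ 3)) := by gcongr
    _ ≤ _ := Nat.pow_le_pow_right (by omega) hk

lemma iterate_all {n : ℕ} {x : ℝ} (hx : 24 ≤ x) (hxn : x ^ 3 = n) (j : ℕ) :
    Cov (fun I => I ⊆ grid n ∧ FreeSet I)
      (fun C => C ⊆ grid n ∧ (C.card : ℝ) ≤ max (12 * x ^ 8) ((6143 / 6144) ^ j * (n : ℝ) ^ 3))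
      (((n ^ 3 + 1) ^ ⌈192 * x ^ 5⌉₊) ^ j) := by
  induction j with
  | zero =>
    refine Cov.single (grid n) (by simp) ⟨Subset.refl _, ?_⟩ (fun I hI => hI.1)
    rw [card_grid]
    simp
  | succ j ih =>
    rw [pow_succ]
    refine ih.bind ?_
    rintro C ⟨hC, hCc⟩
    by_cases h : (C.card : ℝ) ≤ 12 * x ^ 8
    · exact Cov.single C (Nat.one_le_pow _ _ (by positivity)) ⟨hC, le_max_of_le_left h⟩
        (fun I hI => hI.2)
    · push Not at h
      refine (iterate_step hx hxn C hC h.le).mono (fun I hI => ⟨hI.2, hI.1.2⟩) ?_ le_rfl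
      rintro D ⟨hD, hDc⟩
      refine ⟨hD.trans hC, le_max_of_le_right ?_⟩
      have h1 : (C.card : ℝ) ≤ (6143 / 6144) ^ j * (n : ℝ) ^ 3 := by
        rcases le_max_iff.1 hCc with h' | h'
        · linarith
        · exact h'
      have h2 : 6144 * (D.card : ℝ) ≤ 6143 * C.card := by exact_mod_cast hDc
      rw [pow_succ]
      linarith

lemma cov_final {n : ℕ} {x : ℝ} (hx : 24 ≤ x) (hxn : x ^ 3 = n) :
    Cov (fun I => I ⊆ grid n ∧ FreeSet I)
      (fun C => C ⊆ grid n ∧ (C.card : ℝ) ≤ 12 * x ^ 8)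
      ((n ^ 3 + 1) ^ (⌈192 * x ^ 5⌉₊ * ⌈18432 * Real.log n⌉₊)) := by
  have hx0 : 0 < x := by linarith
  have hn0 : (0 : ℝ) < n := by rw [← hxn]; positivity
  have h := iterate_all hx hxn ⌈18432 * Real.log n⌉₊
  rw [← pow_mul] at h
  refine h.mono (fun _ h => h) ?_ le_rfl
  rintro C ⟨h1, h2⟩
  refine ⟨h1, h2.trans (max_le le_rfl ?_)⟩
  set J := ⌈18432 * Real.log n⌉₊ with hJ
  have hJ1 : 18432 * Real.log n ≤ J := Nat.le_ceil _
  have h3 : ((6143 : ℝ) / 6144) ^ J ≤ Real.exp (-(3 * Real.log n)) := by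
    have : (6143 : ℝ) / 6144 ≤ Real.exp (-(1 / 6144)) := by
      have := Real.add_one_le_exp (-(1 / 6144 : ℝ))
      linarith
    calc ((6143 : ℝ) / 6144) ^ J ≤ (Real.exp (-(1 / 6144))) ^ J := by gcongr
      _ = Real.exp (J * (-(1 / 6144))) := by rw [Real.exp_nat_mul]
      _ ≤ _ := by
        apply Real.exp_le_exp.2
        linarith
  have h4 : Real.exp (-(3 * Real.log n)) * (n : ℝ) ^ 3 = 1 := by
    have : (n : ℝ) ^ 3 = Real.exp (3 * Real.log n) := by
      rw [show (3 : ℝ) * Real.log n = (3 : ℕ) * Real.log n by norm_num, Real.exp_nat_mul,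
        Real.exp_log hn0]
    rw [this, ← Real.exp_add]
    simp
  have h5 : (1 : ℝ) ≤ x ^ 8 := one_le_pow₀ (by linarith)
  have h6 : ((6143 : ℝ) / 6144) ^ J * (n : ℝ) ^ 3 ≤ Real.exp (-(3 * Real.log n)) * (n : ℝ) ^ 3 := by
    gcongr
  linarith

open Classical in
/-- The free `m`-subsets of the grid. -/
noncomputable def freeSets (n m : ℕ) : Finset (Finset Pt) :=
  ((grid n).powersetCard m).filter FreeSet

lemma card_freeSets {n : ℕ} {x : ℝ} (hx : 24 ≤ x) (hxn : x ^ 3 = n) (m : ℕ) :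
    (freeSets n m).card ≤ (n ^ 3 + 1) ^ (⌈192 * x ^ 5⌉₊ * ⌈18432 * Real.log n⌉₊) *
      (⌊12 * x ^ 8⌋₊).choose m := by
  classical
  obtain ⟨𝒞, h1, h2, h3⟩ := cov_final hx hxn
  have hsub : freeSets n m ⊆ 𝒞.biUnion (fun C => C.powersetCard m) := by
    intro I hI
    rw [freeSets, mem_filter, mem_powersetCard] at hI
    obtain ⟨C, hC, hIC⟩ := h3 I ⟨hI.1.1, hI.2⟩
    exact mem_biUnion.2 ⟨C, hC, mem_powersetCard.2 ⟨hIC, hI.1.2⟩⟩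
  refine (card_le_card hsub).trans ((card_biUnion_le_card_mul _ _ _ ?_).trans
    (Nat.mul_le_mul_right _ h1))
  intro C hC
  rw [card_powersetCard]
  exact Nat.choose_le_choose _ (Nat.le_floor (h2 C hC).2)

lemma expect_freeSets {n : ℕ} {x p : ℝ} (hx : 24 ≤ x) (hxn : x ^ 3 = n) (m : ℕ) (hp0 : 0 ≤ p)
    (hp : p * x ^ 3 ≤ 1) :
    ((freeSets n m).card : ℝ) * p ^ m ≤
      Real.exp ((192 * x ^ 5 + 1) * (18432 * Real.log n + 1) * Real.log ((n : ℝ) ^ 3 + 1)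
        + 96 * x ^ 5 - 2 * m) := by
  have hx0 : 0 < x := by linarith
  have hn0 : (0 : ℝ) < n := by rw [← hxn]; positivity
  have hn1 : (1 : ℝ) ≤ n := by rw [← hxn]; exact one_le_pow₀ (by linarith)
  have hlog : 0 ≤ Real.log n := Real.log_nonneg hn1
  set K := ⌈192 * x ^ 5⌉₊ with hK
  set J := ⌈18432 * Real.log n⌉₊ with hJ
  have hK' : (K : ℝ) ≤ 192 * x ^ 5 + 1 := (Nat.ceil_lt_add_one (by positivity)).le
  have hJ' : (J : ℝ) ≤ 18432 * Real.log n + 1 := (Nat.ceil_lt_add_one (by positivity)).le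
  have h1 : ((freeSets n m).card : ℝ) ≤ ((n : ℝ) ^ 3 + 1) ^ (K * J) *
      ((⌊12 * x ^ 8⌋₊).choose m : ℝ) := by
    exact_mod_cast card_freeSets hx hxn m
  have h2 : ((⌊12 * x ^ 8⌋₊).choose m : ℝ) ≤ (12 * x ^ 8) ^ m / m.factorial := by
    refine (Nat.choose_le_pow_div m _).trans ?_
    gcongr
    exact Nat.floor_le (by positivity)
  have h3 : ((n : ℝ) ^ 3 + 1) ^ (K * J) ≤ Real.exp ((192 * x ^ 5 + 1) * (18432 * Real.log n + 1)
      * Real.log ((n : ℝ) ^ 3 + 1)) := by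
    have hl : 0 ≤ Real.log ((n : ℝ) ^ 3 + 1) := Real.log_nonneg (by
      have : (0 : ℝ) ≤ (n : ℝ) ^ 3 := by positivity
      linarith)
    calc ((n : ℝ) ^ 3 + 1) ^ (K * J) = Real.exp (((K * J : ℕ) : ℝ) * Real.log ((n : ℝ) ^ 3 + 1)) := by
          rw [Real.exp_nat_mul, Real.exp_log (by positivity)]
      _ ≤ _ := by
        apply Real.exp_le_exp.2
        push_cast
        gcongr
  have h4 : (12 * x ^ 8) ^ m / m.factorial * p ^ m ≤ Real.exp (96 * x ^ 5 - 2 * m) := by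
    have e2 : Real.exp 2 ≤ 8 := by
      have := Real.exp_one_lt_d9
      have h : Real.exp 2 = Real.exp 1 * Real.exp 1 := by rw [← Real.exp_add]; norm_num
      have := Real.exp_pos 1
      nlinarith
    have h5 := Real.pow_div_factorial_le_exp (8 * (12 * x ^ 8 * p)) (by positivity) m
    have h6 : (8 : ℝ) * (12 * x ^ 8 * p) ≤ 96 * x ^ 5 := by
      have : 0 ≤ x ^ 5 := by positivity
      nlinarith [mul_le_mul_of_nonneg_left hp this]
    have h7 : Real.exp (2 * m) ≤ 8 ^ m := by
      rw [mul_comm, Real.exp_nat_mul]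
      gcongr
    rw [Real.exp_sub, le_div_iff₀ (Real.exp_pos _)]
    calc (12 * x ^ 8) ^ m / m.factorial * p ^ m * Real.exp (2 * m)
        ≤ (12 * x ^ 8) ^ m / m.factorial * p ^ m * 8 ^ m := by gcongr
      _ = (8 * (12 * x ^ 8 * p)) ^ m / m.factorial := by
        rw [mul_pow 8, mul_pow _ p]
        ring
      _ ≤ Real.exp (8 * (12 * x ^ 8 * p)) := h5
      _ ≤ _ := Real.exp_le_exp.2 h6
  calc ((freeSets n m).card : ℝ) * p ^ m
      ≤ ((n : ℝ) ^ 3 + 1) ^ (K * J) * ((12 * x ^ 8) ^ m / m.factorial) * p ^ m := by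
        gcongr
        exact h1.trans (by gcongr)
    _ = ((n : ℝ) ^ 3 + 1) ^ (K * J) * ((12 * x ^ 8) ^ m / m.factorial * p ^ m) := by ring
    _ ≤ _ := by
      rw [add_sub_assoc, Real.exp_add]
      gcongr

end Iteration

section Quadruples

/-- Embedding of the integer points into real space. -/
def toR (x : Pt) : Fin 3 → ℝ := fun i => (x i : ℝ)

lemma toR_inj : Function.Injective toR := by
  intro x y h
  funext i
  have := congrFun h i
  simpa [toR] using this

open Classical in
/-- Collinear quadruples in the grid. -/
noncomputable def coll4 (n : ℕ) : Finset (Finset Pt) :=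
  ((grid n).powersetCard 4).filter (fun Q => Collinear ℝ (toR '' (Q : Set Pt)))

lemma cross_of_collinear {Q : Finset Pt} (h : Collinear ℝ (toR '' (Q : Set Pt))) {a b x : Pt}
    (ha : a ∈ Q) (hb : b ∈ Q) (hx : x ∈ Q) (i j : Fin 3) :
    (x - a) i * (b - a) j = (x - a) j * (b - a) i := by
  obtain ⟨v, hv⟩ := (collinear_iff_of_mem (show toR a ∈ toR '' (Q : Set Pt) from
    ⟨a, by simpa using ha, rfl⟩)).1 h
  obtain ⟨r, hr⟩ := hv (toR x) ⟨x, by simpa using hx, rfl⟩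
  obtain ⟨r', hr'⟩ := hv (toR b) ⟨b, by simpa using hb, rfl⟩
  have e1 : ∀ i, (x i : ℝ) - a i = r * v i := by
    intro i
    have := congrFun hr i
    simp [toR] at this
    linarith
  have e2 : ∀ i, (b i : ℝ) - a i = r' * v i := by
    intro i
    have := congrFun hr' i
    simp [toR] at this
    linarith
  have : (((x - a) i * (b - a) j : ℤ) : ℝ) = (((x - a) j * (b - a) i : ℤ) : ℝ) := by
    simp only [Pi.sub_apply]
    push_cast
    rw [e1, e1, e2, e2]
    ring
  exact_mod_cast this

/-- A cbox centred at the origin. -/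
noncomputable def cbox (m : ℕ) : Finset Pt := Fintype.piFinset (fun _ : Fin 3 => Finset.Icc (-(m : ℤ)) m)

lemma card_cbox (m : ℕ) : (cbox m).card = (2 * m + 1) ^ 3 := by
  simp only [cbox, Fintype.card_piFinset, Int.card_Icc, Finset.prod_const, Finset.card_univ,
    Fintype.card_fin]
  congr 1
  omega

lemma coll4_subset (n : ℕ) : coll4 n ⊆ (Finset.Icc 1 n).biUnion (fun g : ℕ =>
    ((grid n) ×ˢ (cbox (n / g)) ×ˢ (Finset.Icc (-(g : ℤ)) g) ×ˢ (Finset.Icc (-(g : ℤ)) g)).image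
      (fun q => ({q.1, q.1 + (g : ℤ) • q.2.1, q.1 + q.2.2.1 • q.2.1, q.1 + q.2.2.2 • q.2.1} :
        Finset Pt))) := by
  classical
  intro Q hQ
  rw [coll4, mem_filter, mem_powersetCard] at hQ
  obtain ⟨⟨hQg, hQc⟩, hcol⟩ := hQ
  obtain ⟨a, ha, b, hb, hab⟩ := one_lt_card.1 (show 1 < Q.card by omega)
  obtain ⟨u, g₀, hu, hg₀, hw⟩ := exists_prim (sub_ne_zero.2 (Ne.symm hab))
  have hpar : ∀ x ∈ Q, ∃ k : ℤ, x - a = k • u := by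
    intro x hx
    apply prim_param hu
    intro i j
    have h := cross_of_collinear hcol ha hb hx i j
    rw [hw] at h
    simp only [Pi.smul_apply, smul_eq_mul] at h
    apply mul_left_cancel₀ hg₀.ne'
    linear_combination h
  choose! k hk using hpar
  have hQa : (Q.erase a).card = 3 := by rw [card_erase_of_mem ha, hQc]
  obtain ⟨c, hc, hmax⟩ := exists_max_image (Q.erase a) (fun x => |k x|)
    (card_pos.1 (by omega))
  have hca : c ≠ a := (mem_erase.1 hc).1
  have hcQ : c ∈ Q := (mem_erase.1 hc).2
  have hkc : k c ≠ 0 := by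
    intro h
    have := hk c hcQ
    rw [h, zero_smul, sub_eq_zero] at this
    exact hca this
  obtain ⟨d, e, hde, hDE⟩ := card_eq_two.1 (show ((Q.erase a).erase c).card = 2 by
    rw [card_erase_of_mem hc, hQa])
  have hd : d ∈ Q.erase a := (erase_subset c _) (by rw [hDE]; simp)
  have he : e ∈ Q.erase a := (erase_subset c _) (by rw [hDE]; simp)
  have hQeq : Q = {a, c, d, e} := by
    rw [← insert_erase ha, ← insert_erase hc, hDE]
  -- normalise sign
  obtain ⟨σ, hσ, hσk⟩ : ∃ σ : ℤ, σ * σ = 1 ∧ σ * k c = |k c| := by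
    rcases abs_choice (k c) with h | h
    · exact ⟨1, by norm_num, by rw [h]; ring⟩
    · exact ⟨-1, by norm_num, by rw [h]; ring⟩
  set g := (k c).natAbs with hg
  have hgabs : (g : ℤ) = |k c| := by simp [hg]
  have hgpos : 1 ≤ g := Int.natAbs_pos.2 hkc
  have hpt : ∀ x ∈ Q, x = a + (σ * k x) • (σ • u) := by
    intro x hx
    rw [smul_smul, show σ * k x * σ = k x by linear_combination (k x) * hσ, ← hk x hx]
    abel
  have hσabs : |σ| = 1 := by
    have : |σ| * |σ| = 1 := by rw [← abs_mul, hσ]; rfl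
    nlinarith [abs_nonneg σ]
  have hu' : ∀ i, (g : ℤ) * |u i| ≤ n := by
    intro i
    have h1 : (c - a) i = k c * u i := by rw [hk c hcQ]; simp
    rw [hgabs, ← abs_mul, ← h1, abs_le]
    have h2 := mem_grid.1 (hQg hcQ) i
    have h3 := mem_grid.1 (hQg ha) i
    simp only [Pi.sub_apply]
    omega
  have hgn : g ≤ n := by
    have hune : ∃ i, u i ≠ 0 := by
      by_contra! hcon
      obtain ⟨l, hl⟩ := hu
      simp [hcon] at hl
    obtain ⟨i, hi⟩ := hune
    have h1 := hu' i
    have h2 : 1 ≤ |u i| := Int.one_le_abs hi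
    have : (g : ℤ) ≤ n := by nlinarith
    exact_mod_cast this
  refine mem_biUnion.2 ⟨g, Finset.mem_Icc.2 ⟨hgpos, hgn⟩, mem_image.2
    ⟨(a, σ • u, σ * k d, σ * k e), ?_, ?_⟩⟩
  · simp only [mem_product, Finset.mem_Icc]
    refine ⟨hQg ha, ?_, ?_, ?_⟩
    · rw [cbox, Fintype.mem_piFinset]
      intro i
      rw [Finset.mem_Icc, ← abs_le]
      simp only [Pi.smul_apply, smul_eq_mul, abs_mul, hσabs, one_mul]
      push_cast
      rw [Int.le_ediv_iff_mul_le (by exact_mod_cast hgpos)]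
      linarith [hu' i]
    · rw [← abs_le, abs_mul, hσabs, one_mul, hgabs]
      exact hmax d hd
    · rw [← abs_le, abs_mul, hσabs, one_mul, hgabs]
      exact hmax e he
  · simp only
    rw [← hpt d (mem_erase.1 hd).2, ← hpt e (mem_erase.1 he).2, hgabs, ← hσk, ← hpt c hcQ, hQeq]

lemma card_coll4 (n : ℕ) : ((coll4 n).card : ℝ) ≤ 243 * (n : ℝ) ^ 6 * (1 + Real.log n) := by
  have h1 : (coll4 n).card ≤ ∑ g ∈ Finset.Icc 1 n,
      n ^ 3 * ((2 * (n / g) + 1) ^ 3 * ((2 * g + 1) * (2 * g + 1))) := by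
    refine (card_le_card (coll4_subset n)).trans (card_biUnion_le.trans (sum_le_sum fun g _ => ?_))
    refine card_image_le.trans (le_of_eq ?_)
    rw [card_product, card_product, card_product, card_grid, card_cbox, Int.card_Icc]
    have : ((g : ℤ) + 1 - -(g : ℤ)).toNat = 2 * g + 1 := by omega
    rw [this]
  have h2 : ((∑ g ∈ Finset.Icc 1 n,
      n ^ 3 * ((2 * (n / g) + 1) ^ 3 * ((2 * g + 1) * (2 * g + 1))) : ℕ) : ℝ) ≤
      ∑ g ∈ Finset.Icc 1 n, 243 * (n : ℝ) ^ 6 * ((g : ℝ)⁻¹) := by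
    push_cast
    refine sum_le_sum fun g hg => ?_
    rw [Finset.mem_Icc] at hg
    have hg0 : (0 : ℝ) < g := by exact_mod_cast hg.1
    have hg1 : (1 : ℝ) ≤ g := by exact_mod_cast hg.1
    have hng : (1 : ℝ) ≤ n / g := by
      rw [le_div_iff₀ hg0, one_mul]
      exact_mod_cast hg.2
    have e1 : (2 * ((n / g : ℕ) : ℝ) + 1) ≤ 3 * (n / g) := by
      have : ((n / g : ℕ) : ℝ) ≤ n / g := Nat.cast_div_le
      linarith
    have e2 : (2 * (g : ℝ) + 1) ≤ 3 * g := by linarith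
    calc (n : ℝ) ^ 3 * ((2 * ((n / g : ℕ) : ℝ) + 1) ^ 3 * ((2 * g + 1) * (2 * g + 1)))
        ≤ (n : ℝ) ^ 3 * ((3 * (n / g)) ^ 3 * ((3 * g) * (3 * g))) := by gcongr
      _ = 243 * (n : ℝ) ^ 6 * ((g : ℝ)⁻¹) := by field_simp; norm_num
  have h3 : ∑ g ∈ Finset.Icc 1 n, ((g : ℝ)⁻¹) ≤ 1 + Real.log n := by
    have := harmonic_le_one_add_log n
    rw [harmonic_eq_sum_Icc] at this
    push_cast at this
    exact this
  have h4 : ((coll4 n).card : ℝ) ≤ _ := le_trans (by exact_mod_cast h1) h2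
  rw [← mul_sum] at h4
  refine h4.trans ?_
  gcongr

end Quadruples

section Probability

variable {V : Type*} [DecidableEq V]

lemma weight_sum (X Q : Finset V) (hQ : Q ⊆ X) (p : ℝ) :
    ∑ S ∈ X.powerset, (if Q ⊆ S then p ^ S.card * (1 - p) ^ (X \ S).card else 0) = p ^ Q.card := by
  have h := prod_add (fun _ : V => p) (fun i => if i ∈ Q then 0 else 1 - p) X
  have h1 : ∏ i ∈ X, (p + if i ∈ Q then 0 else 1 - p) = p ^ Q.card := by
    have : ∀ i ∈ X, (p + if i ∈ Q then 0 else 1 - p) = if i ∈ Q then p else 1 := by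
      intro i _
      split_ifs <;> ring
    rw [prod_congr rfl this, prod_ite_mem, inter_eq_right.2 hQ, prod_const]
  rw [h1] at h
  rw [h]
  refine sum_congr rfl fun S hS => ?_
  rw [mem_powerset] at hS
  by_cases hQS : Q ⊆ S
  · rw [if_pos hQS, prod_const]
    congr 1
    rw [← prod_const]
    refine prod_congr rfl fun i hi => ?_
    rw [if_neg]
    intro hiQ
    exact (mem_sdiff.1 hi).2 (hQS hiQ)
  · rw [if_neg hQS]
    obtain ⟨i, hiQ, hiS⟩ := not_subset.1 hQS
    rw [prod_eq_zero (i := i) (s := X \ S) (mem_sdiff.2 ⟨hQ hiQ, hiS⟩) (by simp [hiQ]), mul_zero]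

lemma weight_count (X : Finset V) (𝒜 : Finset (Finset V)) (r : ℕ)
    (h𝒜 : ∀ Q ∈ 𝒜, Q ⊆ X ∧ Q.card = r) (p : ℝ) :
    ∑ S ∈ X.powerset, p ^ S.card * (1 - p) ^ (X \ S).card * ((𝒜.filter (fun Q => Q ⊆ S)).card : ℝ)
      = 𝒜.card * p ^ r := by
  have : ∀ S ∈ X.powerset, p ^ S.card * (1 - p) ^ (X \ S).card *
      ((𝒜.filter (fun Q => Q ⊆ S)).card : ℝ) =
      ∑ Q ∈ 𝒜, (if Q ⊆ S then p ^ S.card * (1 - p) ^ (X \ S).card else 0) := by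
    intro S _
    rw [← sum_filter, sum_const, nsmul_eq_mul, mul_comm]
  rw [sum_congr rfl this, sum_comm]
  rw [sum_congr rfl (fun Q hQ => weight_sum X Q (h𝒜 Q hQ).1 p)]
  rw [sum_congr rfl (fun Q hQ => by rw [(h𝒜 Q hQ).2]), sum_const, nsmul_eq_mul]

lemma exists_random (X : Finset V) (𝒜 ℬ : Finset (Finset V)) (r m : ℕ)
    (h𝒜 : ∀ Q ∈ 𝒜, Q ⊆ X ∧ Q.card = r) (hℬ : ∀ Q ∈ ℬ, Q ⊆ X ∧ Q.card = m)
    (p W : ℝ) (hp0 : 0 < p) (hp1 : p < 1) :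
    ∃ S ⊆ X, X.card * p - 𝒜.card * p ^ r - W * (ℬ.card * p ^ m) ≤
      (S.card : ℝ) - ((𝒜.filter (fun Q => Q ⊆ S)).card : ℝ)
        - W * ((ℬ.filter (fun Q => Q ⊆ S)).card : ℝ) := by
  set 𝒮 := X.image (fun x => ({x} : Finset V)) with h𝒮
  have hinj : Function.Injective (fun x : V => ({x} : Finset V)) := singleton_injective
  have hS1 := weight_count X 𝒮 1 (by
    intro Q hQ
    obtain ⟨x, hx, rfl⟩ := mem_image.1 hQ
    simp [hx]) p
  have hS2 : 𝒮.card = X.card := card_image_of_injective _ hinj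
  have hS3 : ∀ S ∈ X.powerset, (𝒮.filter (fun Q => Q ⊆ S)).card = S.card := by
    intro S hS
    rw [mem_powerset] at hS
    rw [← card_image_of_injective S hinj]
    congr 1
    ext Q
    simp only [h𝒮, mem_filter, mem_image]
    constructor
    · rintro ⟨⟨x, hx, rfl⟩, h⟩
      exact ⟨x, by simpa using h, rfl⟩
    · rintro ⟨x, hx, rfl⟩
      exact ⟨⟨x, hS hx, rfl⟩, by simpa using hx⟩
  have hA := weight_count X 𝒜 r h𝒜 p
  have hB := weight_count X ℬ m hℬ p
  have h1 : ∑ S ∈ X.powerset, p ^ S.card * (1 - p) ^ (X \ S).card = 1 := by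
    have := weight_sum X ∅ (by simp) p
    simpa using this
  rw [hS2, pow_one] at hS1
  rw [sum_congr rfl (fun S hS => by rw [hS3 S hS])] at hS1
  have key : ∑ S ∈ X.powerset, p ^ S.card * (1 - p) ^ (X \ S).card *
      (X.card * p - 𝒜.card * p ^ r - W * (ℬ.card * p ^ m)) ≤
      ∑ S ∈ X.powerset, p ^ S.card * (1 - p) ^ (X \ S).card *
      ((S.card : ℝ) - ((𝒜.filter (fun Q => Q ⊆ S)).card : ℝ)
        - W * ((ℬ.filter (fun Q => Q ⊆ S)).card : ℝ)) := by
    rw [← sum_mul, h1, one_mul, ← hS1, ← hA, ← hB, mul_sum, ← sum_sub_distrib, ← sum_sub_distrib]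
    refine sum_le_sum fun S _ => le_of_eq ?_
    ring
  obtain ⟨S, hS, hle⟩ := exists_le_of_sum_le ⟨∅, by simp⟩ key
  refine ⟨S, mem_powerset.1 hS, ?_⟩
  refine le_of_mul_le_mul_left hle ?_
  have : 0 < 1 - p := by linarith
  positivity

end Probability

section Final

open Filter Topology

lemma final_fixed {n m : ℕ} {x lam : ℝ} (hx : 24 ≤ x) (hxn : x ^ 3 = n)
    (hlam : 2000 ≤ lam) (hlamn : lam ≤ n) (hlog : 1 + Real.log n ≤ 2 * lam ^ 2)
    (hexp : (n : ℝ) ^ 3 * Real.exp ((192 * x ^ 5 + 1) * (18432 * Real.log n + 1) *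
      Real.log ((n : ℝ) ^ 3 + 1) + 96 * x ^ 5 - 2 * m) ≤ 1) :
    ∃ S ⊆ grid n, (∀ Q ⊆ S, Q.card = 4 → ¬ Collinear ℝ (toR '' (Q : Set Pt))) ∧
      S.card = ⌈(n : ℝ) ^ 2 / (2 * lam)⌉₊ ∧ ∀ T ⊆ S, m ≤ T.card → ¬ FreeSet T := by
  classical
  have hn0 : (0 : ℝ) < n := by linarith
  have hl0 : 0 < lam := by linarith
  set p : ℝ := 1 / (n * lam) with hp
  have hp0 : 0 < p := by positivity
  have hp1 : p < 1 := by
    rw [hp, div_lt_one (by positivity)]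
    nlinarith
  have hpx : p * x ^ 3 ≤ 1 := by
    rw [hxn, hp]
    rw [div_mul_eq_mul_div, div_le_one (by positivity)]
    nlinarith
  obtain ⟨S, hSX, hS⟩ := exists_random (grid n) (coll4 n) (freeSets n m) 4 m
    (fun Q hQ => mem_powersetCard.1 (mem_filter.1 hQ).1)
    (fun Q hQ => mem_powersetCard.1 (mem_filter.1 hQ).1) p ((n : ℝ) ^ 3) hp0 hp1
  have hB : (n : ℝ) ^ 3 * ((freeSets n m).card * p ^ m) ≤ 1 := by
    refine le_trans ?_ hexp
    gcongr
    exact expect_freeSets hx hxn m hp0.le hpx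
  have hA : ((coll4 n).card : ℝ) * p ^ 4 ≤ 486 * (n : ℝ) ^ 2 / lam ^ 2 := by
    calc ((coll4 n).card : ℝ) * p ^ 4 ≤ (243 * (n : ℝ) ^ 6 * (1 + Real.log n)) * p ^ 4 := by
          gcongr
          exact card_coll4 n
      _ ≤ (243 * (n : ℝ) ^ 6 * (2 * lam ^ 2)) * p ^ 4 := by gcongr
      _ = _ := by
        rw [hp]
        field_simp
        norm_num
  have hX : ((grid n).card : ℝ) * p = (n : ℝ) ^ 2 / lam := by
    rw [card_grid, hp]
    push_cast
    field_simp
  have hval : (n : ℝ) ^ 2 / (2 * lam) ≤ (S.card : ℝ) - (((coll4 n).filter (fun Q => Q ⊆ S)).card : ℝ)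
        - (n : ℝ) ^ 3 * (((freeSets n m).filter (fun Q => Q ⊆ S)).card : ℝ) := by
    refine le_trans ?_ hS
    rw [hX]
    have h1 : 486 * (n : ℝ) ^ 2 / lam ^ 2 ≤ (n : ℝ) ^ 2 / lam / 4 := by
      rw [div_div, div_le_div_iff₀ (by positivity) (by positivity)]
      have : 0 ≤ (n : ℝ) ^ 2 * lam := by positivity
      nlinarith
    have h2 : 1 ≤ (n : ℝ) ^ 2 / lam / 4 := by
      rw [div_div, le_div_iff₀ (by positivity)]
      nlinarith
    have h3 : (n : ℝ) ^ 2 / (2 * lam) = (n : ℝ) ^ 2 / lam / 2 := by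
      rw [div_div, mul_comm lam 2]
    linarith
  have hpos : 0 < (n : ℝ) ^ 2 / (2 * lam) := by positivity
  have hSn : (S.card : ℝ) ≤ (n : ℝ) ^ 3 := by
    have := card_le_card hSX
    rw [card_grid] at this
    exact_mod_cast this
  have hfree : (freeSets n m).filter (fun Q => Q ⊆ S) = ∅ := by
    by_contra hne
    have h1 : 1 ≤ ((freeSets n m).filter (fun Q => Q ⊆ S)).card :=
      card_pos.2 (nonempty_iff_ne_empty.2 hne)
    have h2 : (1 : ℝ) ≤ (((freeSets n m).filter (fun Q => Q ⊆ S)).card : ℝ) := by exact_mod_cast h1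
    have h3 : (n : ℝ) ^ 3 * 1 ≤ (n : ℝ) ^ 3 * (((freeSets n m).filter (fun Q => Q ⊆ S)).card : ℝ) := by
      gcongr
    have h4 : (0 : ℝ) ≤ (((coll4 n).filter (fun Q => Q ⊆ S)).card : ℝ) := by positivity
    linarith
  rw [hfree] at hval
  simp only [card_empty, Nat.cast_zero, mul_zero, sub_zero] at hval
  have hpick : ∀ Q ∈ coll4 n, ∃ c, c ∈ Q := by
    intro Q hQ
    have := (mem_powersetCard.1 (mem_filter.1 hQ).1).2
    exact card_pos.1 (by omega)
  choose! c hc using hpick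
  set S1 := S \ ((coll4 n).filter (fun Q => Q ⊆ S)).image c with hS1
  have hS1c : (n : ℝ) ^ 2 / (2 * lam) ≤ S1.card := by
    have h1 : S.card ≤ S1.card + ((coll4 n).filter (fun Q => Q ⊆ S)).card := by
      have := le_card_sdiff (((coll4 n).filter (fun Q => Q ⊆ S)).image c) S
      have h2 := card_image_le (s := (coll4 n).filter (fun Q => Q ⊆ S)) (f := c)
      rw [← hS1] at this
      omega
    have h2 : (S.card : ℝ) ≤ S1.card + ((coll4 n).filter (fun Q => Q ⊆ S)).card := by
      exact_mod_cast h1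
    linarith
  obtain ⟨S2, hS2, hS2c⟩ := exists_subset_card_eq (Nat.ceil_le.2 hS1c)
  have hS2S : S2 ⊆ S := hS2.trans sdiff_subset
  refine ⟨S2, hS2S.trans hSX, ?_, hS2c, ?_⟩
  · intro Q hQ hQc hcol
    have hQ4 : Q ∈ coll4 n :=
      mem_filter.2 ⟨mem_powersetCard.2 ⟨hQ.trans (hS2S.trans hSX), hQc⟩, hcol⟩
    have h1 := hS2 (hQ (hc Q hQ4))
    exact (mem_sdiff.1 h1).2 (mem_image.2 ⟨Q, mem_filter.2 ⟨hQ4, hQ.trans hS2S⟩, rfl⟩)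
  · intro T hT hTm hfreeT
    obtain ⟨T', hT', hT'c⟩ := exists_subset_card_eq hTm
    have : T' ∈ (freeSets n m).filter (fun Q => Q ⊆ S) := by
      refine mem_filter.2 ⟨mem_filter.2 ⟨mem_powersetCard.2 ⟨?_, hT'c⟩, ?_⟩, ?_⟩
      · exact hT'.trans (hT.trans (hS2S.trans hSX))
      · exact fun Q hQ => hfreeT Q (hQ.trans hT')
      · exact hT'.trans (hT.trans hS2S)
    rw [hfree] at this
    simp at this

lemma collinear_of_isCol {Q : Finset Pt} (h : IsCol Q) :
    Collinear ℝ (toR '' (Q : Set Pt)) := by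
  obtain ⟨a, u, h⟩ := h
  rw [collinear_iff_exists_forall_eq_smul_vadd]
  refine ⟨toR a, toR u, ?_⟩
  rintro _ ⟨x, hx, rfl⟩
  obtain ⟨k, hk⟩ := h x (by simpa using hx)
  refine ⟨k, ?_⟩
  funext i
  rw [hk]
  simp [toR]
  ring

lemma eventually_exp (f : ℝ) (hf : 0 < f) : ∀ᶠ n : ℕ in atTop, ∀ m : ℕ,
    (n : ℝ) ^ ((5 : ℝ) / 3 + f) ≤ m →
    (n : ℝ) ^ 3 * Real.exp ((192 * ((n : ℝ) ^ ((1 : ℝ) / 3)) ^ 5 + 1) * (18432 * Real.log n + 1) *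
      Real.log ((n : ℝ) ^ 3 + 1) + 96 * ((n : ℝ) ^ ((1 : ℝ) / 3)) ^ 5 - 2 * m) ≤ 1 := by
  have h1 := (isLittleO_log_rpow_rpow_atTop (2 : ℝ) hf).bound
    (show (0 : ℝ) < 1 / 20000000 by norm_num)
  have h2 := tendsto_natCast_atTop_atTop (R := ℝ) |>.eventually h1
  filter_upwards [h2, eventually_ge_atTop 3] with n hn hn3 m hm
  have hn3' : (3 : ℝ) ≤ n := by exact_mod_cast hn3
  have hn0 : (0 : ℝ) < n := by linarith
  set x := (n : ℝ) ^ ((1 : ℝ) / 3) with hx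
  have hx1 : 1 ≤ x := Real.one_le_rpow (by linarith) (by norm_num)
  have hx5 : x ^ 5 = (n : ℝ) ^ ((5 : ℝ) / 3) := by
    rw [hx, ← Real.rpow_natCast, ← Real.rpow_mul hn0.le]
    norm_num
  set l := Real.log n with hl
  have hl1 : 1 ≤ l := by
    rw [hl, Real.le_log_iff_exp_le hn0]
    have := Real.exp_one_lt_d9
    linarith
  have hn' : 20000000 * l ^ 2 ≤ (n : ℝ) ^ f := by
    rw [Real.norm_of_nonneg (by positivity), Real.norm_of_nonneg (by positivity)] at hn
    have : l ^ (2 : ℝ) = l ^ 2 := by norm_cast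
    rw [this] at hn
    linarith
  rw [Real.rpow_add hn0, ← hx5] at hm
  have hlog4 : Real.log ((n : ℝ) ^ 3 + 1) ≤ 4 * l := by
    rw [hl, show (4 : ℝ) * Real.log n = ((4 : ℕ) : ℝ) * Real.log n by norm_num, ← Real.log_pow]
    apply Real.log_le_log (by positivity)
    have : (1 : ℝ) ≤ (n : ℝ) ^ 3 := one_le_pow₀ (by linarith)
    nlinarith
  have hlog0 : 0 ≤ Real.log ((n : ℝ) ^ 3 + 1) := Real.log_nonneg (by
    have : (0 : ℝ) ≤ (n : ℝ) ^ 3 := by positivity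
    linarith)
  have hn3e : (n : ℝ) ^ 3 = Real.exp (3 * l) := by
    rw [show (3 : ℝ) * l = (3 : ℕ) * l by norm_num, Real.exp_nat_mul, hl, Real.exp_log hn0]
  have hxx : (1 : ℝ) ≤ x ^ 5 := one_le_pow₀ hx1
  have e1 : (192 * x ^ 5 + 1) * (18432 * l + 1) * Real.log ((n : ℝ) ^ 3 + 1) ≤
      (193 * x ^ 5) * (18433 * l) * (4 * l) := by
    gcongr <;> linarith
  have hl2 : l ≤ l ^ 2 := by nlinarith
  have e2 : 3 * l ≤ 3 * (x ^ 5 * l ^ 2) := by nlinarith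
  have e3 : 96 * x ^ 5 ≤ 96 * (x ^ 5 * l ^ 2) := by nlinarith
  have e4 : x ^ 5 * (20000000 * l ^ 2) ≤ m := le_trans (by gcongr) hm
  rw [show (n : ℝ) ^ 3 * Real.exp ((192 * x ^ 5 + 1) * (18432 * l + 1) *
      Real.log ((n : ℝ) ^ 3 + 1) + 96 * x ^ 5 - 2 * m) = Real.exp (3 * l + ((192 * x ^ 5 + 1) *
      (18432 * l + 1) * Real.log ((n : ℝ) ^ 3 + 1) + 96 * x ^ 5 - 2 * m)) by
    rw [Real.exp_add, ← hn3e], Real.exp_le_one_iff]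
  have e5 : 0 ≤ x ^ 5 * l ^ 2 := by positivity
  nlinarith

end Final


/-- The core probabilistic construction in the proof of Theorem 1 of the paper: for every
f > 0 and n large, there is S ⊆ [n]³ with no four collinear points, of size roughly
n²/(log₂ n)^(1/2), such that every T ⊆ S of size at least n^(5/3+f) contains three
collinear points. -/
theorem container_construction_grid3 :
    ∀ f : ℝ, 0 < f → ∃ n₀ : ℕ, ∀ n : ℕ, n₀ ≤ n →
      ∃ S : Finset (Fin 3 → ℝ), (S : Set (Fin 3 → ℝ)) ⊆ gridPts n ∧
        (∀ Q ⊆ S, Q.card = 4 → ¬ Collinear ℝ (Q : Set (Fin 3 → ℝ))) ∧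
        (n : ℝ) ^ 2 / (2 * (Real.logb 2 (n : ℝ)) ^ ((1 : ℝ) / 2)) ≤ (S.card : ℝ) ∧
        (S.card : ℝ) ≤ 2 * (n : ℝ) ^ 2 / (Real.logb 2 (n : ℝ)) ^ ((1 : ℝ) / 2) ∧
        ∀ T ⊆ S, (n : ℝ) ^ ((5 : ℝ) / 3 + f) ≤ (T.card : ℝ) →
          ∃ Q ⊆ T, Q.card = 3 ∧ Collinear ℝ (Q : Set (Fin 3 → ℝ)) := by
  intro f hf
  have hL : Filter.Tendsto (fun n : ℕ => Real.logb 2 (n : ℝ)) Filter.atTop Filter.atTop :=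
    (Real.tendsto_logb_atTop (by norm_num)).comp tendsto_natCast_atTop_atTop
  have ev : ∀ᶠ n : ℕ in Filter.atTop, 24 ^ 3 ≤ n ∧ (4000000 : ℝ) ≤ Real.logb 2 (n : ℝ) ∧ _ :=
    (Filter.eventually_ge_atTop (24 ^ 3)).and
      ((hL.eventually_ge_atTop 4000000).and (eventually_exp f hf))
  obtain ⟨n₀, hn₀⟩ := Filter.eventually_atTop.1 ev
  refine ⟨n₀, fun n hn => ?_⟩
  obtain ⟨hn24, hLn, hexp⟩ := hn₀ n hn
  have hn24' : (24 : ℝ) ^ 3 ≤ n := by exact_mod_cast hn24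
  have hn0 : (0 : ℝ) < n := lt_of_lt_of_le (by norm_num) hn24'
  set x := (n : ℝ) ^ ((1 : ℝ) / 3) with hx
  have hxn : x ^ 3 = n := by
    rw [hx, ← Real.rpow_natCast, ← Real.rpow_mul hn0.le]
    norm_num
  have hx0 : 0 ≤ x := by positivity
  have hx24 : 24 ≤ x := by
    rw [← hxn] at hn24'
    exact le_of_pow_le_pow_left₀ (by norm_num) hx0 hn24'
  set Lg := Real.logb 2 (n : ℝ) with hLg
  rw [← Real.sqrt_eq_rpow]
  set lam := Real.sqrt Lg with hlamdef
  have hLg0 : 0 ≤ Lg := by linarith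
  have hlam2 : lam ^ 2 = Lg := Real.sq_sqrt hLg0
  have hlam0 : 0 ≤ lam := Real.sqrt_nonneg _
  have hlam : 2000 ≤ lam := Real.le_sqrt_of_sq_le (by norm_num; linarith)
  have hlogle : Real.log n ≤ Lg := by
    rw [hLg, Real.logb, le_div_iff₀ (Real.log_pos (by norm_num))]
    have h1 : Real.log 2 ≤ 1 := by linarith [Real.log_two_lt_d9]
    have h2 : 0 ≤ Real.log n := Real.log_nonneg (by linarith [show (1 : ℝ) ≤ 24 ^ 3 by norm_num])
    nlinarith
  have hlamn : lam ≤ n := by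
    have h1 : Lg ≤ 2 * n := by
      rw [hLg, Real.logb, div_le_iff₀ (Real.log_pos (by norm_num))]
      have h1 : (1 : ℝ) / 2 ≤ Real.log 2 := by linarith [Real.log_two_gt_d9]
      have h2 := Real.log_le_sub_one_of_pos hn0
      nlinarith
    nlinarith
  obtain ⟨S, hS, h4, hc, hT⟩ := final_fixed (m := ⌈(n : ℝ) ^ ((5 : ℝ) / 3 + f)⌉₊) hx24 hxn hlam hlamn
    (by rw [hlam2]; linarith) (hexp _ (Nat.le_ceil _))
  have hcard : (S.image toR).card = S.card := card_image_of_injective _ toR_inj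
  refine ⟨S.image toR, ?_, ?_, ?_, ?_, ?_⟩
  · intro q hq
    obtain ⟨y, hy, rfl⟩ := mem_image.1 (mem_coe.1 hq)
    intro i
    have := mem_grid.1 (hS hy) i
    refine ⟨(y i).toNat, by omega, by omega, ?_⟩
    have h0 : ((y i).toNat : ℤ) = y i := Int.toNat_of_nonneg (by omega)
    have h : ((y i : ℤ) : ℝ) = ((y i).toNat : ℝ) := by
      rw [← Int.cast_natCast, h0]
    exact h
  · intro Q hQ hQc
    obtain ⟨Q', hQ', rfl⟩ := subset_image_iff.1 hQ
    rw [card_image_of_injective _ toR_inj] at hQc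
    rw [coe_image]
    exact h4 Q' hQ' hQc
  · rw [hcard, hc]
    exact Nat.le_ceil _
  · rw [hcard, hc]
    have h1 := (Nat.ceil_lt_add_one (show 0 ≤ (n : ℝ) ^ 2 / (2 * lam) by positivity)).le
    refine h1.trans ?_
    have h2 : 1 ≤ (n : ℝ) ^ 2 / lam := by
      rw [le_div_iff₀ (by linarith)]
      nlinarith
    have h3 : (n : ℝ) ^ 2 / (2 * lam) = (n : ℝ) ^ 2 / lam / 2 := by
      rw [div_div, mul_comm lam 2]
    have h4 : 2 * (n : ℝ) ^ 2 / lam = 2 * ((n : ℝ) ^ 2 / lam) := by ring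
    linarith
  · intro T hTS hTc
    obtain ⟨T', hT', rfl⟩ := subset_image_iff.1 hTS
    rw [card_image_of_injective _ toR_inj] at hTc
    have := hT T' hT' (Nat.ceil_le.2 hTc)
    unfold FreeSet at this
    push Not at this
    obtain ⟨Q, hQT, hQc, hQ⟩ := this
    refine ⟨Q.image toR, image_subset_image hQT, ?_, ?_⟩
    · rw [card_image_of_injective _ toR_inj, hQc]
    · rw [coe_image]
      exact collinear_of_isCol hQ
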